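/- Let k ∈ ℕ and suppose G ≤ Aut(T) acts without inversions, is geometrically dense and satisfies Property P_k. Then the subgroup G^{+_k} := ⟨Fix_G(e^{k-1}) : e an edge of T⟩ is either trivial or abstractly simple. -/

import Mathlib

/-!
STATEMENT 6 (Tits' simplicity theorem, version for Property P_k).  Suppose G ≤ Aut(T)
acts without inversions, is geometrically dense and satisfies Property P_k.  Then
G^{+_k} := ⟨Fix_G(e^{k-1}) : e an edge⟩ is either trivial or abstractly simple.
-/

def IsTreeAut {V : Type*} (T : SimpleGraph V) (g : Equiv.Perm V) : Prop :=
  ∀ u v : V, T.Adj (g u) (g v) ↔ T.Adj u v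

def IsInversion {V : Type*} (T : SimpleGraph V) (g : Equiv.Perm V) : Prop :=
  ∃ u v : V, T.Adj u v ∧ g u = v ∧ g v = u

def NotLine {V : Type*} (T : SimpleGraph V) : Prop :=
  ¬ ∀ v : V, (T.neighborSet v).ncard = 2

def IsConvex {V : Type*} (T : SimpleGraph V) (X : Set V) : Prop :=
  ∀ u ∈ X, ∀ v ∈ X, ∀ p : T.Walk u v, p.IsPath → ∀ w ∈ p.support, w ∈ X

def IsRay {V : Type*} (T : SimpleGraph V) (r : ℕ → V) : Prop :=
  (∀ n, T.Adj (r n) (r (n+1))) ∧ Function.Injective r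

def RayEquiv {V : Type*} (r s : ℕ → V) : Prop :=
  ∃ m n : ℕ, ∀ i : ℕ, r (m + i) = s (n + i)

/-- Geometric density: no fixed end and no invariant proper nonempty subtree. -/
def GeomDense {V : Type*} (T : SimpleGraph V) (S : Set (Equiv.Perm V)) : Prop :=
  (¬ ∃ r : ℕ → V, IsRay T r ∧ ∀ g ∈ S, RayEquiv (fun n => g (r n)) r) ∧
  ¬ ∃ Y : Set V, Y.Nonempty ∧ IsConvex T Y ∧ Y ≠ Set.univ ∧ ∀ g ∈ S, ∀ v ∈ Y, g v ∈ Y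

/-- A path in the tree: a nonempty convex set of vertices in which every vertex has at
most two neighbours.  This covers finite, one-sided infinite and bi-infinite paths. -/
def IsPathSet {V : Type*} (T : SimpleGraph V) (C : Set V) : Prop :=
  C.Nonempty ∧ IsConvex T C ∧
    ∀ x ∈ C, ∀ w₁ ∈ C, ∀ w₂ ∈ C, ∀ w₃ ∈ C,
      T.Adj x w₁ → T.Adj x w₂ → T.Adj x w₃ → (w₁ = w₂ ∨ w₁ = w₃ ∨ w₂ = w₃)

/-- The m-neighbourhood Cᵐ of a set of vertices: all vertices at distance at most m. -/
def nbhd {V : Type*} (T : SimpleGraph V) (C : Set V) (m : ℕ) : Set V :=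
  {v | ∃ c ∈ C, T.dist v c ≤ m}

/-- T_x = π_C⁻¹(x): the vertices whose nearest point of C is x. -/
def projSet {V : Type*} (T : SimpleGraph V) (C : Set V) (x : V) : Set V :=
  {v | ∀ c ∈ C, T.dist v x ≤ T.dist v c}

/-- Property P_k for a set S of automorphisms: for every path C, the natural injective
homomorphism from the pointwise stabilizer of C^{k-1} in S to the product over x ∈ C of
the permutation groups induced on the subtrees T_x is an isomorphism.  Injectivity says
that an element of the stabilizer acting trivially on each T_x is trivial; surjectivity
says that any family of restrictions can be realized simultaneously by one element. -/
def PropertyPk {V : Type*} (T : SimpleGraph V) (S : Set (Equiv.Perm V)) (k : ℕ) : Prop :=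
  ∀ C : Set V, IsPathSet T C →
    ((∀ g ∈ S, (∀ v ∈ nbhd T C (k-1), g v = v) →
        (∀ x ∈ C, ∀ v ∈ projSet T C x, g v = v) → g = 1) ∧
     (∀ h : V → Equiv.Perm V,
        (∀ x ∈ C, h x ∈ S ∧ ∀ v ∈ nbhd T C (k-1), (h x) v = v) →
        ∃ g ∈ S, (∀ v ∈ nbhd T C (k-1), g v = v) ∧
          ∀ x ∈ C, ∀ v ∈ projSet T C x, g v = (h x) v))

/-- G^{+_k}: the subgroup generated by the pointwise stabilizers in S of the
(k-1)-neighbourhoods e^{k-1} of edges e. -/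
def plusSubgroup {V : Type*} (T : SimpleGraph V) (S : Set (Equiv.Perm V)) (k : ℕ) :
    Subgroup (Equiv.Perm V) :=
  Subgroup.closure
    {g | g ∈ S ∧ ∃ u v : V, T.Adj u v ∧ ∀ w ∈ nbhd T ({u, v} : Set V) (k-1), g w = w}

namespace TitsAux

open SimpleGraph

/-- The half-tree at `x` of the edge `xy`. -/
def HT {V : Type*} (T : SimpleGraph V) (x y : V) : Set V := {v | T.dist v x < T.dist v y}

/-- Metric convexity. -/
def BConv {V : Type*} (T : SimpleGraph V) (X : Set V) : Prop :=
  ∀ u ∈ X, ∀ v ∈ X, ∀ w, T.dist u w + T.dist w v = T.dist u v → w ∈ X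

section basics

variable {V : Type*} {T : SimpleGraph V}

theorem step (hT : T.IsTree) (v : V) {x y : V} (h : T.Adj x y) :
    T.dist v x = T.dist v y + 1 ∨ T.dist v y = T.dist v x + 1 :=
  hT.dist_eq_dist_add_one_of_adj v h

theorem tri (hT : T.IsTree) (u v w : V) : T.dist u w ≤ T.dist u v + T.dist v w :=
  hT.connected.dist_triangle

theorem dzero (hT : T.IsTree) {u v : V} : T.dist u v = 0 ↔ u = v :=
  hT.connected.dist_eq_zero_iff

theorem toward_unique (hT : T.IsTree) {v x a b : V} (ha : T.Adj x a) (hb : T.Adj x b)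
    (hva : T.dist v a < T.dist v x) (hvb : T.dist v b < T.dist v x) : a = b := by
  have key : ∀ c, T.Adj x c → T.dist v c < T.dist v x →
      ∃ p : T.Walk x v, p.IsPath ∧ p.snd = c := by
    intro c hc hlt
    obtain ⟨p, hp⟩ := hT.connected.exists_walk_length_eq_dist c v
    refine ⟨Walk.cons hc p, ?_, by simp⟩
    apply Walk.isPath_of_length_eq_dist
    have := step hT v hc
    rw [Walk.length_cons, hp, T.dist_comm, T.dist_comm (u := x)]
    omega
  obtain ⟨p, hp, rfl⟩ := key a ha hva
  obtain ⟨q, hq, rfl⟩ := key b hb hvb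
  rw [(hT.existsUnique_path x v).unique hp hq]

theorem exists_toward (hT : T.IsTree) {v x : V} (h : x ≠ v) :
    ∃ a, T.Adj x a ∧ T.dist v x = T.dist v a + 1 := by
  obtain ⟨p, hp⟩ := hT.connected.exists_walk_length_eq_dist x v
  cases p with
  | nil => exact absurd rfl h
  | @cons _ a _ hadj p =>
    refine ⟨a, hadj, ?_⟩
    have h1 := T.dist_le p
    rw [Walk.length_cons] at hp
    have h2 := step hT v hadj
    rw [T.dist_comm] at h1 hp
    omega

theorem IsConvex_of_BConv (hT : T.IsTree) {X : Set V} (h : BConv T X) : IsConvex T X := by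
  classical
  intro u hu v hv p hp w hw
  apply h u hu v hv w
  obtain ⟨q, hq, hql⟩ := hT.connected.exists_path_of_dist u v
  have hpq : p = q := (hT.existsUnique_path u v).unique hp hq
  subst hpq
  have h1 := T.dist_le (p.takeUntil w hw)
  have h2 := T.dist_le (p.dropUntil w hw)
  have h3 := congrArg Walk.length (p.take_spec hw)
  rw [Walk.length_append] at h3
  have h4 := tri hT u w v
  omega

theorem not_mem_HT (hT : T.IsTree) {x y v : V} (h : T.Adj x y) : v ∉ HT T x y ↔ v ∈ HT T y x := by
  have := step hT v h
  simp only [HT, Set.mem_ofPred_eq]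
  omega

theorem mem_HT_left {x y : V} (h : T.Adj x y) : x ∈ HT T x y := by
  simp [HT, (dist_eq_one_iff_adj.2 h)]

theorem gate (hT : T.IsTree) {x y : V} (h : T.Adj x y) {u w : V} (hu : u ∈ HT T y x)
    (hw : w ∈ HT T x y) : T.dist u w = T.dist u x + T.dist x w := by
  simp only [HT, Set.mem_ofPred_eq] at hu
  obtain ⟨n, hn⟩ : ∃ n, T.dist x w = n := ⟨_, rfl⟩
  induction n using Nat.strong_induction_on generalizing w with
  | _ n ih =>
    by_cases hwx : w = x
    · subst hwx; simp
    obtain ⟨w', hadj, hd⟩ := exists_toward hT hwx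
    have hw0 : T.dist w x < T.dist w y := hw
    have hy := step hT y hadj
    have hw' : w' ∈ HT T x y := by
      simp only [HT, Set.mem_ofPred_eq]
      rw [T.dist_comm (u := w), T.dist_comm (u := w)] at hw0
      rw [T.dist_comm (u := w'), T.dist_comm (u := w')]
      omega
    have e := ih (T.dist x w') (by omega) hw' rfl
    rcases step hT u hadj with h1 | h1
    · omega
    · exfalso
      by_cases hx : w' = x
      · subst hx
        have : w = y := toward_unique hT (v := u) hadj.symm h (by omega) hu
        subst this
        simp at hw0
      · obtain ⟨w'', hadj', hd'⟩ := exists_toward hT hx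
        have hw2 : w'' ∈ HT T x y := by
          have hw0 : T.dist w' x < T.dist w' y := hw'
          have hy := step hT y hadj'
          simp only [HT, Set.mem_ofPred_eq]
          rw [T.dist_comm (u := w'), T.dist_comm (u := w')] at hw0
          rw [T.dist_comm (u := w''), T.dist_comm (u := w'')]
          omega
        have e' := ih (T.dist x w'') (by omega) hw2 rfl
        have : w = w'' := toward_unique hT (v := u) hadj.symm hadj' (by omega) (by omega)
        subst this
        omega

theorem HT_conv (hT : T.IsTree) {x y : V} (h : T.Adj x y) : BConv T (HT T x y) := by
  intro u hu v hv w hw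
  by_contra hn
  have hn' := (not_mem_HT hT h).1 hn
  have h1 := gate hT h hn' hu
  have h2 := gate hT h hn' hv
  have h3 : T.dist w y < T.dist w x := hn'
  have h4 := tri hT u x v
  rw [T.dist_comm (u := u) (v := w)] at hw
  rw [T.dist_comm (u := u) (v := x)] at h4
  omega

/-- Nesting of half-trees. -/
theorem nesting (hT : T.IsTree) {x y a b : V} (h : T.Adj x y) (h' : T.Adj a b) :
    HT T x y ⊆ HT T a b ∨ HT T y x ⊆ HT T a b ∨ HT T x y ⊆ HT T b a ∨ HT T y x ⊆ HT T b a := by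
  have key : ∀ x y, T.Adj x y → a ∈ HT T x y → b ∈ HT T x y →
      HT T y x ⊆ HT T a b ∨ HT T y x ⊆ HT T b a := by
    intro x y h ha hb
    rcases step hT x h' with e | e
    · right
      intro w hw
      have h1 := gate hT h hw ha
      have h2 := gate hT h hw hb
      simp only [HT, Set.mem_ofPred_eq]
      omega
    · left
      intro w hw
      have h1 := gate hT h hw ha
      have h2 := gate hT h hw hb
      simp only [HT, Set.mem_ofPred_eq]
      omega
  have key2 : ∀ x y a b, T.Adj x y → T.Adj a b → a ∈ HT T x y → b ∈ HT T y x → a = x ∧ b = y := by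
    intro x y a b h h' ha hb
    have h1 := gate hT h hb ha
    have h2 : T.dist b y < T.dist b x := hb
    have h3 : T.dist b a = 1 := dist_eq_one_iff_adj.2 h'.symm
    exact ⟨((dzero hT).1 (by omega : T.dist x a = 0)).symm, (dzero hT).1 (by omega)⟩
  by_cases ha : a ∈ HT T x y
  · by_cases hb : b ∈ HT T x y
    · rcases key x y h ha hb with h | h <;> simp [h]
    · obtain ⟨rfl, rfl⟩ := key2 x y a b h h' ha ((not_mem_HT hT h).1 hb)
      simp
  · rw [not_mem_HT hT h] at ha
    by_cases hb : b ∈ HT T x y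
    · obtain ⟨rfl, rfl⟩ := key2 y x a b h.symm h' ha hb
      simp
    · rw [not_mem_HT hT h] at hb
      rcases key y x h.symm ha hb with h | h <;> simp [h]

/-- Points on a segment are determined by the distance to an end. -/
theorem seg_unique (hT : T.IsTree) {u v w w' : V} (h : T.dist u w + T.dist w v = T.dist u v)
    (h' : T.dist u w' + T.dist w' v = T.dist u v) (e : T.dist u w = T.dist u w') : w = w' := by
  obtain ⟨n, hn⟩ : ∃ n, T.dist w v = n := ⟨_, rfl⟩
  induction n generalizing w w' with
  | zero =>
    rw [(dzero hT).1 hn, (dzero hT).1 (by omega : T.dist w' v = 0)]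
  | succ n ih =>
    have h1 : w ≠ v := by rintro rfl; simp at hn
    have h2 : w' ≠ v := by
      rintro rfl
      simp at h'
      omega
    obtain ⟨z, hz, hdz⟩ := exists_toward hT h1
    obtain ⟨z', hz', hdz'⟩ := exists_toward hT h2
    rw [T.dist_comm, T.dist_comm (u := v)] at hdz hdz'
    have a1 := tri hT u z v
    have a2 := tri hT u z' v
    have a3 := step hT u hz
    have a4 := step hT u hz'
    have : z = z' := ih (by omega) (by omega) (by omega) (by omega)
    subst this
    exact toward_unique hT hz.symm hz'.symm (v := u) (by omega) (by omega)

theorem aut_dist (hT : T.IsTree) {g : Equiv.Perm V} (hg : IsTreeAut T g) (u v : V) :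
    T.dist (g u) (g v) = T.dist u v := by
  have le : ∀ g : Equiv.Perm V, IsTreeAut T g → ∀ u v, T.dist (g u) (g v) ≤ T.dist u v := by
    intro g hg u v
    obtain ⟨p, hp⟩ := hT.connected.exists_walk_length_eq_dist u v
    let f : T →g T := ⟨g, fun {a b} h => (hg a b).2 h⟩
    have := T.dist_le (p.map f)
    rw [Walk.length_map, hp] at this
    exact this
  apply le_antisymm (le g hg u v)
  have hg' : IsTreeAut T g⁻¹ := by
    intro a b
    rw [← hg]; simp
  simpa using le g⁻¹ hg' (g u) (g v)

theorem aut_HT (hT : T.IsTree) {g : Equiv.Perm V} (hg : IsTreeAut T g) {x y v : V} :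
    g v ∈ HT T (g x) (g y) ↔ v ∈ HT T x y := by
  simp [HT, aut_dist hT hg]

end basics

/-- A map sending each vertex to the next vertex towards a fixed end. -/
structure EndMap {V : Type*} (T : SimpleGraph V) (s : V → V) : Prop where
  adj : ∀ v, T.Adj v (s v)
  nb : ∀ v, s (s v) ≠ v
  dir : ∀ v w, T.Adj v w → s v = w ∨ s w = v

/-- Geometric density, phrased with end maps and metric convexity. -/
def Dense {V : Type*} (T : SimpleGraph V) (N : Subgroup (Equiv.Perm V)) : Prop :=
  (¬ ∃ s : V → V, EndMap T s ∧ ∀ g ∈ N, ∀ v, g (s v) = s (g v)) ∧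
  ¬ ∃ Y : Set V, Y.Nonempty ∧ BConv T Y ∧ Y ≠ Set.univ ∧ ∀ g ∈ N, ∀ v ∈ Y, g v ∈ Y

theorem pai {V : Type*} (g : Equiv.Perm V) (v : V) : g (g⁻¹ v) = v := by simp

theorem pia {V : Type*} (g : Equiv.Perm V) (v : V) : g⁻¹ (g v) = v := by simp

section density

variable {V : Type*} {T : SimpleGraph V}

theorem EndMap.dist (hT : T.IsTree) {s : V → V} (hs : EndMap T s) (v : V) (i : ℕ) :
    T.dist v (s^[i] v) = i ∧ T.dist v (s^[i+1] v) = i + 1 := by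
  induction i with
  | zero => simpa using dist_eq_one_iff_adj.2 (hs.adj v)
  | succ i ih =>
    refine ⟨ih.2, ?_⟩
    have a1 := hs.adj (s^[i+1] v)
    have a0 := hs.adj (s^[i] v)
    have n0 := hs.nb (s^[i] v)
    rw [← Function.iterate_succ_apply' s] at a0 a1 n0
    rw [← Function.iterate_succ_apply' s] at n0
    have := step hT v a1
    rcases this with e | e
    · exact absurd (toward_unique hT (v := v) a1 a0.symm (by omega) (by omega)) n0
    · simp only [Nat.succ_eq_add_one] at *
      omega

theorem EndMap.merge (hT : T.IsTree) {s : V → V} (hs : EndMap T s) (u w : V) :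
    ∃ m n, s^[m] u = s^[n] w := by
  obtain ⟨p⟩ := hT.connected u w
  induction p with
  | nil => exact ⟨0, 0, rfl⟩
  | @cons a b c h p ih =>
    obtain ⟨m, n, e⟩ := ih
    rcases hs.dir _ _ h with h1 | h1
    · exact ⟨m + 1, n, by rw [Function.iterate_succ_apply, h1, e]⟩
    · exact ⟨m, n + 1, by
        rw [← h1, ← Function.iterate_succ_apply, Function.iterate_succ_apply', e,
          ← Function.iterate_succ_apply' s]⟩

theorem dense_of_geomDense (hT : T.IsTree) {G : Subgroup (Equiv.Perm V)}
    (hgd : GeomDense T (G : Set (Equiv.Perm V))) : Dense T G := by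
  constructor
  · rintro ⟨s, hs, hc⟩
    apply hgd.1
    obtain ⟨v⟩ := hT.connected.nonempty
    have inj : ∀ i j, s^[i] v = s^[i + j] v → j = 0 := by
      intro i j h
      have := (hs.dist hT (s^[i] v) j).1
      rw [← Function.iterate_add_apply, add_comm j i, ← h] at this
      simpa using this.symm
    refine ⟨fun n => s^[n] v, ⟨fun n => ?_, fun i j h => ?_⟩, fun g hg => ?_⟩
    · simp only [Function.iterate_succ_apply']
      exact hs.adj _
    · rcases le_total i j with hij | hij
      · obtain ⟨l, rfl⟩ := Nat.exists_eq_add_of_le hij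
        simp [inj i l h]
      · obtain ⟨l, rfl⟩ := Nat.exists_eq_add_of_le hij
        simp [inj j l h.symm]
    · obtain ⟨m, n, e⟩ := hs.merge hT (g v) v
      refine ⟨m, n, fun i => ?_⟩
      have hcomm : ∀ i, g (s^[i] v) = s^[i] (g v) := by
        intro i
        induction i with
        | zero => rfl
        | succ i ih => rw [Function.iterate_succ_apply', Function.iterate_succ_apply', hc g hg, ih]
      simp only [hcomm]
      rw [add_comm m i, add_comm n i, Function.iterate_add_apply, Function.iterate_add_apply, e]
  · rintro ⟨Y, h1, h2, h3, h4⟩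
    exact hgd.2 ⟨Y, h1, IsConvex_of_BConv hT h2, h3, h4⟩

/-- Flipping lemma. -/
theorem flip (hT : T.IsTree) {N : Subgroup (Equiv.Perm V)} (hN : ∀ g ∈ N, IsTreeAut T g)
    (hd : Dense T N) {x y : V} (h : T.Adj x y) :
    ∃ n ∈ N, ∀ v ∈ HT T x y, n v ∈ HT T y x := by
  by_contra hcon
  push Not at hcon
  have hadj : ∀ g ∈ N, T.Adj (g x) (g y) := fun g hg => (hN g hg x y).2 h
  -- translates pairwise meet
  have meet : ∀ g ∈ N, ∀ g' ∈ N, ∃ u, u ∈ HT T (g x) (g y) ∧ u ∈ HT T (g' x) (g' y) := by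
    intro g hg g' hg'
    obtain ⟨v, hv, hv'⟩ := hcon (g'⁻¹ * g) (N.mul_mem (N.inv_mem hg') hg)
    refine ⟨g v, (aut_HT hT (hN g hg)).2 hv, ?_⟩
    rw [not_mem_HT hT h.symm, ← aut_HT hT (hN g' hg')] at hv'
    simpa using hv'
  by_cases hne : ∃ v, ∀ g ∈ N, v ∈ HT T (g x) (g y)
  · apply hd.2
    obtain ⟨v0, hv0⟩ := hne
    refine ⟨{v | ∀ g ∈ N, v ∈ HT T (g x) (g y)}, ⟨v0, hv0⟩, ?_, ?_, ?_⟩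
    · intro u hu v hv w hw g hg
      exact HT_conv hT (hadj g hg) u (hu g hg) v (hv g hg) w hw
    · intro e
      have : y ∈ {v | ∀ g ∈ N, v ∈ HT T (g x) (g y)} := by rw [e]; trivial
      have := this 1 N.one_mem
      exact (not_mem_HT hT h).2 (mem_HT_left h.symm) this
    · intro g hg v hv g' hg'
      have := hv (g⁻¹ * g') (N.mul_mem (N.inv_mem hg) hg')
      rw [← aut_HT hT (hN g hg)] at this
      simpa using this
  · push Not at hne
    apply hd.1
    let R : V → V → Prop := fun v w => T.Adj v w ∧ ∃ g ∈ N, HT T (g x) (g y) ⊆ HT T w v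
    have ex : ∀ v, ∃ w, R v w := by
      intro v
      obtain ⟨g, hg, hv⟩ := hne v
      have hvx : v ≠ g x := by
        rintro rfl
        exact hv (mem_HT_left (hadj g hg))
      obtain ⟨w, hw, hd⟩ := exists_toward hT hvx
      refine ⟨w, hw, g, hg, fun u hu => ?_⟩
      have h1 := gate hT (hadj g hg) ((not_mem_HT hT (hadj g hg)).1 hv) hu
      have h2 := tri hT w (g x) u
      simp only [HT, Set.mem_ofPred_eq]
      rw [T.dist_comm (u := u), T.dist_comm (u := u)]
      rw [T.dist_comm, T.dist_comm (u := g x) (v := w)] at hd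
      omega
    have uniq : ∀ v w w', R v w → R v w' → w = w' := by
      rintro v w w' ⟨hw, g, hg, hs⟩ ⟨hw', g', hg', hs'⟩
      obtain ⟨u, hu, hu'⟩ := meet g hg g' hg'
      exact toward_unique hT hw hw' (hs hu) (hs' hu')
    have noback : ∀ v w, R v w → ¬ R w v := by
      rintro v w ⟨hw, g, hg, hs⟩ ⟨hw', g', hg', hs'⟩
      obtain ⟨u, hu, hu'⟩ := meet g hg g' hg'
      exact (not_mem_HT hT hw).2 (hs hu) (hs' hu')
    choose s hs using ex
    refine ⟨s, ⟨fun v => (hs v).1, fun v e => ?_, fun v w hvw => ?_⟩, fun g hg v => ?_⟩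
    · have := hs (s v)
      rw [e] at this
      exact noback _ _ (hs v) this
    · by_cases e : s v = w
      · exact Or.inl e
      · right
        obtain ⟨ha, g, hg, hsub⟩ := hs v
        refine uniq _ _ _ (hs w) ⟨hvw.symm, g, hg, fun u hu => ?_⟩
        by_contra hu'
        rw [not_mem_HT hT hvw] at hu'
        exact e (toward_unique hT ha hvw (hsub hu) hu')
    · refine uniq _ _ _ ?_ (hs (g v))
      obtain ⟨ha, g', hg', hsub⟩ := hs v
      refine ⟨(hN g hg _ _).2 ha, g * g', N.mul_mem hg hg', fun u hu => ?_⟩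
      have : g⁻¹ u ∈ HT T (g' x) (g' y) := by
        rw [← aut_HT hT (hN g hg)]
        simpa using hu
      have := hsub this
      rw [← aut_HT hT (hN g hg)] at this
      simpa using this

theorem EndMap.toward (hT : T.IsTree) {s : V → V} (hs : EndMap T s) {w z : V}
    (hz : z ∈ HT T w (s w)) (hne : z ≠ w) : T.dist w (s z) < T.dist w z := by
  obtain ⟨n, hn⟩ : ∃ n, T.dist w z = n := ⟨_, rfl⟩
  induction n using Nat.strong_induction_on generalizing z with
  | _ n ih =>
    obtain ⟨z', hadj, hd⟩ := exists_toward hT hne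
    have hw0 : T.dist z w < T.dist z (s w) := hz
    have hy := step hT (s w) hadj
    have hz' : z' ∈ HT T w (s w) := by
      simp only [HT, Set.mem_ofPred_eq]
      rw [T.dist_comm (u := z), T.dist_comm (u := z)] at hw0
      rw [T.dist_comm (u := z'), T.dist_comm (u := z')]
      omega
    have : s z' ≠ z := by
      rintro rfl
      by_cases e : z' = w
      · subst e
        simp at hw0
      · have := ih (T.dist w z') (by omega) hz' e rfl
        omega
    rcases hs.dir _ _ hadj with e | e
    · rw [e]; omega
    · exact absurd e this

/-- A nontrivial normal subgroup of a dense group is dense. -/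
theorem dense_normal (hT : T.IsTree) (hline : NotLine T) {G N : Subgroup (Equiv.Perm V)}
    (hG : ∀ g ∈ G, IsTreeAut T g) (hd : Dense T G) (hNG : N ≤ G) (hN : N ≠ ⊥)
    (hnorm : ∀ g ∈ G, ∀ n ∈ N, g * n * g⁻¹ ∈ N) : Dense T N := by
  have hnorm' : ∀ g ∈ G, ∀ n ∈ N, g⁻¹ * n * g ∈ N := by
    intro g hg n hn
    simpa using hnorm g⁻¹ (G.inv_mem hg) n hn
  -- no fixed vertex
  have nofix : ∀ v, ¬ ∀ n ∈ N, n v = v := by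
    intro v hv
    apply hN
    by_cases hu : {v | ∀ n ∈ N, n v = v} = Set.univ
    · rw [Subgroup.eq_bot_iff_forall]
      intro n hn
      ext u
      have : u ∈ {v | ∀ n ∈ N, n v = v} := by rw [hu]; trivial
      exact this n hn
    · exfalso
      apply hd.2
      refine ⟨{v | ∀ n ∈ N, n v = v}, ⟨v, hv⟩, ?_, hu, ?_⟩
      · intro a ha b hb w hw n hn
        have h1 := aut_dist hT (hG n (hNG hn)) a w
        have h2 := aut_dist hT (hG n (hNG hn)) w b
        rw [ha n hn] at h1
        rw [hb n hn] at h2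
        exact seg_unique hT (by omega) hw h1
      · intro g hg u hu n hn
        have := hu _ (hnorm' g hg n hn)
        simp only [Equiv.Perm.mul_apply] at this
        rw [Equiv.Perm.inv_eq_iff_eq] at this
        exact this
  -- minimality
  have hmin : ¬ ∃ Y : Set V, Y.Nonempty ∧ BConv T Y ∧ Y ≠ Set.univ ∧ ∀ g ∈ N, ∀ v ∈ Y, g v ∈ Y := by
    rintro ⟨Y, ⟨y0, hy0⟩, hconv, hne, hinv⟩
    obtain ⟨x0, hx0⟩ := (Set.ne_univ_iff_exists_notMem _).1 hne
    obtain ⟨p⟩ := hT.connected y0 x0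
    obtain ⟨⟨⟨y, x⟩, hadj⟩, -, hy, hx⟩ := p.exists_boundary_dart Y hy0 hx0
    simp only at hy hx hadj
    have hsub : Y ⊆ HT T y x := by
      intro u hu
      by_contra hc
      rw [not_mem_HT hT hadj] at hc
      have hc' : T.dist u x < T.dist u y := hc
      apply hx
      apply hconv u hu y hy x
      have h1 := step hT u hadj
      have h2 : T.dist x y = 1 := dist_eq_one_iff_adj.2 hadj.symm
      omega
    obtain ⟨g, hg, hflip⟩ := flip hT hG hd hadj
    apply nofix y
    intro n hn
    have hw : g y ∈ HT T x y := hflip _ (hsub hy)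
    have hnw : n (g y) ∈ HT T x y := by
      have h1 := hflip _ (hsub (hinv _ (hnorm' g hg n hn) y hy))
      simpa using h1
    have h1 := gate hT hadj hnw (hsub (hinv n hn y hy))
    have h2 := gate hT hadj hw (hsub (hinv n⁻¹ (N.inv_mem hn) y hy))
    have h3 := aut_dist hT (hG n (hNG hn)) (g y) y
    have h4 := aut_dist hT (hG n (hNG hn)) (g y) (n⁻¹ y)
    simp only [pai] at h4
    exact ((dzero hT).1 (by omega : T.dist y (n y) = 0)).symm
  refine ⟨?_, hmin⟩
  rintro ⟨s, hs, hc⟩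
  apply hd.1
  refine ⟨s, hs, ?_⟩
  by_contra hcon
  push Not at hcon
  obtain ⟨g, hg, v0, hv0⟩ := hcon
  let s' : V → V := fun v => g (s (g⁻¹ v))
  have hs' : EndMap T s' := by
    refine ⟨fun v => ?_, fun v e => ?_, fun v w h => ?_⟩
    · have := (hG g hg _ _).2 (hs.adj (g⁻¹ v))
      simpa [s'] using this
    · simp only [s', pia] at e
      apply hs.nb (g⁻¹ v)
      rw [Equiv.Perm.eq_inv_iff_eq, e]
    · have h' : T.Adj (g⁻¹ v) (g⁻¹ w) := (hG g⁻¹ (G.inv_mem hg) _ _).2 h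
      rcases hs.dir _ _ h' with e | e
      · left; simp only [s', e, pai]
      · right; simp only [s', e, pai]
  have hc' : ∀ n ∈ N, ∀ v, n (s' v) = s' (n v) := by
    intro n hn v
    have := hc _ (hnorm' g hg n hn) (g⁻¹ v)
    simp only [Equiv.Perm.mul_apply, pai] at this
    rw [Equiv.Perm.inv_eq_iff_eq] at this
    exact this
  have hY : {v | s v ≠ s' v} = Set.univ := by
    by_contra hne
    refine hmin ⟨{v | s v ≠ s' v}, ⟨g v0, ?_⟩, ?_, hne, ?_⟩
    · simp only [s', Set.mem_ofPred_eq, pia]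
      exact fun e => hv0 e.symm
    · intro u hu v hv w hw
      by_contra hwn
      have hwe : s w = s' w := by simpa using hwn
      have key : ∀ z, z ∈ HT T w (s w) → s z = s' z := by
        intro z hz
        by_cases e : z = w
        · rw [e, hwe]
        · exact toward_unique hT (v := w) (hs.adj z) (hs'.adj z) (hs.toward hT hz e)
            (hs'.toward hT (hwe ▸ hz) e)
      have ha := hs.adj w
      have hu' : u ∈ HT T (s w) w := by
        rw [← not_mem_HT hT ha]
        exact fun h => hu (key u h)
      have hv' : v ∈ HT T (s w) w := by
        rw [← not_mem_HT hT ha]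
        exact fun h => hv (key v h)
      exact (not_mem_HT hT ha).2 (HT_conv hT ha.symm u hu' v hv' w hw) (mem_HT_left ha)
    · intro n hn v hv e
      apply hv
      rw [← hc n hn, ← hc' n hn] at e
      exact n.injective e
  apply hline
  intro v
  have hall : ∀ w, s w ≠ s' w := fun w => by
    have : w ∈ {v | s v ≠ s' v} := by rw [hY]; trivial
    exact this
  have : T.neighborSet v = {s v, s' v} := by
    ext w
    simp only [mem_neighborSet, Set.mem_insert_iff, Set.mem_singleton_iff]
    constructor
    · intro h
      by_contra hcn
      push Not at hcn
      have h1 := (hs.dir _ _ h).resolve_left hcn.1.symm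
      have h2 := (hs'.dir _ _ h).resolve_left hcn.2.symm
      exact hall w (h1.trans h2.symm)
    · rintro (rfl | rfl)
      · exact hs.adj v
      · exact hs'.adj v
  rw [this, Set.ncard_pair (hall v)]

/-- Any half-tree can be moved into any other. -/
theorem move (hT : T.IsTree) {N : Subgroup (Equiv.Perm V)} (hN : ∀ g ∈ N, IsTreeAut T g)
    (hd : Dense T N) {x y a b : V} (h : T.Adj x y) (h' : T.Adj a b) :
    ∃ n ∈ N, ∀ v ∈ HT T x y, n v ∈ HT T a b := by
  obtain ⟨m, hm, hm'⟩ := flip hT hN hd h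
  obtain ⟨c, hc, hc'⟩ := flip hT hN hd h'.symm
  rcases nesting hT h h' with e | e | e | e
  · exact ⟨1, N.one_mem, fun v hv => e hv⟩
  · exact ⟨m, hm, fun v hv => e (hm' v hv)⟩
  · exact ⟨c, hc, fun v hv => hc' _ (e hv)⟩
  · exact ⟨c * m, N.mul_mem hc hm, fun v hv => hc' _ (e (hm' v hv))⟩

/-- Existence of a branching vertex. -/
theorem branch (hT : T.IsTree) (hline : NotLine T) {N : Subgroup (Equiv.Perm V)}
    (hN : ∀ g ∈ N, IsTreeAut T g) (hinv : ∀ g ∈ N, ¬ IsInversion T g)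
    (hd : Dense T N) {x y : V} (h : T.Adj x y) :
    ∃ v a b c, T.Adj v a ∧ T.Adj v b ∧ T.Adj v c ∧ a ≠ b ∧ a ≠ c ∧ b ≠ c := by
  by_contra hcon
  apply hline
  intro v
  obtain ⟨u, hu⟩ : ∃ u, v ≠ u := by
    by_cases e : v = x
    · exact ⟨y, e ▸ h.ne⟩
    · exact ⟨x, e⟩
  obtain ⟨a, ha, -⟩ := exists_toward hT hu
  obtain ⟨b, hb, hab⟩ : ∃ b, T.Adj v b ∧ a ≠ b := by
    by_contra hno
    push Not at hno
    have hsing : ∀ u ∈ HT T v a, u = v := by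
      intro u hu
      by_contra hne
      obtain ⟨b, hb, hd⟩ := exists_toward hT (Ne.symm hne)
      have := hno b hb
      subst this
      have hu' : T.dist u v < T.dist u a := hu
      omega
    obtain ⟨m, hm, hm'⟩ := flip hT hN hd ha.symm
    have h1 : m a = v := hsing _ (hm' a (mem_HT_left ha.symm))
    have h2 : T.Adj v (m v) := h1 ▸ (hN m hm a v).2 ha.symm
    exact hinv m hm ⟨v, a, ha, (hno _ h2).symm, h1⟩
  have : T.neighborSet v = {a, b} := by
    ext w
    simp only [mem_neighborSet, Set.mem_insert_iff, Set.mem_singleton_iff]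
    constructor
    · intro hw
      by_contra hcn
      push Not at hcn
      exact hcon ⟨v, a, b, w, ha, hb, hw, hab, hcn.1.symm, hcn.2.symm⟩
    · rintro (rfl | rfl) <;> assumption
  rw [this, Set.ncard_pair hab]

end density

section main

variable {V : Type*} {T : SimpleGraph V}

theorem aut_HT' (hT : T.IsTree) {g : Equiv.Perm V} (hg : IsTreeAut T g) {x y v : V} :
    v ∈ HT T (g x) (g y) ↔ g⁻¹ v ∈ HT T x y := by
  rw [← aut_HT hT hg (v := g⁻¹ v), pai]

theorem HT_sub (hT : T.IsTree) {v a b : V} (ha : T.Adj v a) (hb : T.Adj v b) (hab : a ≠ b) :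
    HT T b v ⊆ HT T v a := by
  intro u hu
  by_contra h
  rw [not_mem_HT hT ha] at h
  exact hab (toward_unique hT ha hb h hu)

theorem seg_exists (hT : T.IsTree) (p w : V) (i : ℕ) (hi : i ≤ T.dist p w) :
    ∃ u, T.dist p u = i ∧ T.dist p u + T.dist u w = T.dist p w := by
  induction i with
  | zero => exact ⟨p, by simp, by simp⟩
  | succ i ih =>
    obtain ⟨u, h1, h2⟩ := ih (by omega)
    have hne : u ≠ w := by
      rintro rfl
      omega
    obtain ⟨z, hz, hd⟩ := exists_toward hT hne
    rw [T.dist_comm, T.dist_comm (u := w)] at hd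
    have h3 := tri hT p z w
    have h4 := step hT p hz
    exact ⟨z, by omega, by omega⟩

theorem seg_conv (hT : T.IsTree) (p q : V) :
    BConv T {u | T.dist p u + T.dist u q = T.dist p q} := by
  have key : ∀ u w z, T.dist p u + T.dist u q = T.dist p q → T.dist p w + T.dist w q = T.dist p q →
      T.dist p u ≤ T.dist p w → T.dist u z + T.dist z w = T.dist u w →
      T.dist p z + T.dist z q = T.dist p q := by
    intro u w z hu hw hle hz
    obtain ⟨u', h1, h2⟩ := seg_exists hT p w _ hle
    have h3 := tri hT u' w q
    have h4 := tri hT p u' q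
    have : u' = u := seg_unique hT (by omega : _ = T.dist p q) hu h1
    subst this
    have h5 := tri hT p u' z
    have h6 := tri hT z w q
    have h7 := tri hT p z q
    omega
  intro u hu w hw z hz
  simp only [Set.mem_ofPred_eq] at hu hw ⊢
  rcases le_total (T.dist p u) (T.dist p w) with h | h
  · exact key u w z hu hw h hz
  · refine key w u z hw hu h ?_
    rw [T.dist_comm (u := w) (v := z), T.dist_comm (u := z) (v := u), T.dist_comm (u := w)]
    omega

/-- An element of a dense group translating away from a given half-tree. -/
theorem skewer (hT : T.IsTree) (hline : NotLine T) {N : Subgroup (Equiv.Perm V)}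
    (hN : ∀ g ∈ N, IsTreeAut T g) (hinv : ∀ g ∈ N, ¬ IsInversion T g)
    (hd : Dense T N) {x y : V} (h : T.Adj x y) :
    ∃ n ∈ N, ∃ v a b c, T.Adj v a ∧ T.Adj v b ∧ T.Adj v c ∧ a ≠ b ∧ a ≠ c ∧ b ≠ c ∧
      (∀ u ∈ HT T v a, n u ∈ HT T b v) ∧ HT T x y ⊆ HT T c v := by
  obtain ⟨v, a, b, c, ha, hb, hc, hab, hac, hbc⟩ := branch hT hline hN hinv hd h
  obtain ⟨t, ht, ht'⟩ := move hT hN hd ha hb.symm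
  obtain ⟨m, hm, hm'⟩ := move hT hN hd hc h.symm
  refine ⟨m * t * m⁻¹, N.mul_mem (N.mul_mem hm ht) (N.inv_mem hm), m v, m a, m b, m c,
    (hN m hm _ _).2 ha, (hN m hm _ _).2 hb, (hN m hm _ _).2 hc, m.injective.ne hab,
    m.injective.ne hac, m.injective.ne hbc, ?_, ?_⟩
  · intro u hu
    rw [← pai m u, aut_HT hT (hN m hm)] at hu
    simp only [Equiv.Perm.mul_apply]
    rw [aut_HT hT (hN m hm)]
    exact ht' _ hu
  · intro u hu
    by_contra hcon
    rw [← pai m u, aut_HT hT (hN m hm), not_mem_HT hT hc.symm] at hcon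
    have := hm' _ hcon
    rw [pai] at this
    exact (not_mem_HT hT h).2 this hu

theorem half_mem (hT : T.IsTree) (hline : NotLine T) {k : ℕ}
    {G N : Subgroup (Equiv.Perm V)} (hG : ∀ g ∈ G, IsTreeAut T g)
    (hinv : ∀ g ∈ G, ¬ IsInversion T g)
    (hPk : PropertyPk T (G : Set (Equiv.Perm V)) k)
    (hNG : N ≤ G) (hd : Dense T N)
    (hnorm : ∀ g ∈ plusSubgroup T (G : Set (Equiv.Perm V)) k, ∀ n ∈ N, g * n * g⁻¹ ∈ N)
    {x y : V} (hxy : T.Adj x y) {f : Equiv.Perm V} (hf : f ∈ G)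
    (hf1 : ∀ w ∈ nbhd T ({x, y} : Set V) (k-1), f w = w)
    (hf2 : ∀ w ∈ HT T y x, f w = w) : f ∈ N := by
  classical
  obtain ⟨n, hn, v, a, b, c, ha, hb, hc, hab, hac, hbc, hP, hA⟩ :=
    skewer hT hline (fun g hg => hG g (hNG hg)) (fun g hg => hinv g (hNG hg)) hd hxy
  have hng : ∀ i : ℕ, n ^ i ∈ G := fun i => G.pow_mem (hNG hn) i
  have haut : ∀ i : ℕ, IsTreeAut T (n ^ i) := fun i => hG _ (hng i)
  have hvP : v ∈ HT T v a := mem_HT_left ha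
  have hvb : v ∉ HT T b v := (not_mem_HT hT hb.symm).2 (mem_HT_left hb)
  have hbP : HT T b v ⊆ HT T v a := HT_sub hT ha hb hab
  have hcP : HT T c v ⊆ HT T v a := HT_sub hT ha hc hac
  have hbc' : ∀ u, u ∈ HT T b v → u ∉ HT T c v := fun u hu hu' =>
    hbc (toward_unique hT hb hc hu hu')
  have F1 : ∀ i : ℕ, ∀ u ∈ HT T v a, (n ^ (i+1)) u ∈ HT T b v := by
    intro i
    induction i with
    | zero => simpa using hP
    | succ i ih =>
      intro u hu
      rw [pow_succ', Equiv.Perm.mul_apply]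
      exact hP _ (hbP (ih u hu))
  have F3 : ∀ i j : ℕ, (n ^ j) v ∈ HT T ((n ^ i) v) ((n ^ i) c) := by
    intro i j
    rcases le_or_gt i j with hij | hij
    · obtain ⟨l, rfl⟩ := Nat.exists_eq_add_of_le hij
      rw [pow_add, Equiv.Perm.mul_apply, aut_HT hT (haut i)]
      cases l with
      | zero => simpa using mem_HT_left hc
      | succ l => exact HT_sub hT hc hb hbc.symm (F1 l v hvP)
    · obtain ⟨l, rfl⟩ := Nat.exists_eq_add_of_lt hij
      rw [add_assoc, pow_add, Equiv.Perm.mul_apply, Equiv.Perm.mul_apply, aut_HT hT (haut j)]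
      by_contra hcon
      have hadj : T.Adj ((n ^ (l+1)) v) ((n ^ (l+1)) c) := (haut _ _ _).2 hc
      rw [not_mem_HT hT hadj, aut_HT' hT (haut _)] at hcon
      have := F1 l _ (hcP hcon)
      rw [pai] at this
      exact hvb this
  have hadd : ∀ j : ℕ, T.dist v ((n ^ (j+1)) v) =
      T.dist v ((n ^ j) v) + T.dist ((n ^ j) v) ((n ^ (j+1)) v) := by
    intro j
    cases j with
    | zero => simp
    | succ j =>
      have hadj : T.Adj ((n ^ (j+1)) v) ((n ^ (j+1)) a) := (haut _ _ _).2 ha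
      refine gate hT hadj ?_ ?_
      · by_contra hcon
        rw [not_mem_HT hT hadj.symm, aut_HT' hT (haut _)] at hcon
        have := F1 j _ hcon
        rw [pai] at this
        exact hvb this
      · rw [pow_succ n (j+1), Equiv.Perm.mul_apply, aut_HT hT (haut _)]
        exact hbP (hP v hvP)
  let Seg : ℕ → Set V := fun j => {u | T.dist v u + T.dist u ((n ^ j) v) = T.dist v ((n ^ j) v)}
  have hmono : Monotone Seg := by
    apply monotone_nat_of_le_succ
    intro j u hu
    have h0 : T.dist v u + T.dist u ((n ^ j) v) = T.dist v ((n ^ j) v) := hu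
    have h1 := hadd j
    have h2 := tri hT u ((n ^ j) v) ((n ^ (j+1)) v)
    have h3 := tri hT v u ((n ^ (j+1)) v)
    change T.dist v u + T.dist u ((n ^ (j+1)) v) = T.dist v ((n ^ (j+1)) v)
    omega
  let C : Set V := {u | ∃ j, u ∈ Seg j}
  have hvC : ∀ i : ℕ, (n ^ i) v ∈ C := fun i => ⟨i, by simp [Seg]⟩
  have hC : IsPathSet T C := by
    refine ⟨⟨v, by simpa using hvC 0⟩, IsConvex_of_BConv hT ?_, ?_⟩
    · rintro u ⟨i, hu⟩ w ⟨j, hw⟩ z hz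
      exact ⟨max i j, seg_conv hT _ _ u (hmono (le_max_left i j) hu) w
        (hmono (le_max_right i j) hw) z hz⟩
    · rintro z ⟨j0, hz⟩ w1 ⟨j1, h1⟩ w2 ⟨j2, h2⟩ w3 ⟨j3, h3⟩ a1 a2 a3
      have l1 : w1 ∈ Seg (j0 + j1 + j2 + j3) := hmono (by omega) h1
      have l2 : w2 ∈ Seg (j0 + j1 + j2 + j3) := hmono (by omega) h2
      have l3 : w3 ∈ Seg (j0 + j1 + j2 + j3) := hmono (by omega) h3
      have s1 := step hT v a1
      have s2 := step hT v a2
      have s3 := step hT v a3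
      by_cases e12 : T.dist v w1 = T.dist v w2
      · exact Or.inl (seg_unique hT l1 l2 e12)
      by_cases e13 : T.dist v w1 = T.dist v w3
      · exact Or.inr (Or.inl (seg_unique hT l1 l3 e13))
      · exact Or.inr (Or.inr (seg_unique hT l2 l3 (by omega)))
  have hCQ : ∀ i : ℕ, ∀ u ∈ C, u ∈ HT T ((n ^ i) v) ((n ^ i) c) := by
    rintro i u ⟨j, hu⟩
    have hadj : T.Adj ((n ^ i) v) ((n ^ i) c) := (haut _ _ _).2 hc
    exact HT_conv hT hadj v (by simpa using F3 i 0) _ (F3 i j) u hu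
  have hproj : ∀ i : ℕ, ∀ w, (n ^ i)⁻¹ w ∈ HT T x y → w ∈ projSet T C ((n ^ i) v) := by
    intro i w hw z hz
    have hadj : T.Adj ((n ^ i) v) ((n ^ i) c) := (haut _ _ _).2 hc
    have hw' := hA hw
    rw [← aut_HT hT (haut i), pai] at hw'
    have := gate hT hadj hw' (hCQ i z hz)
    omega
  have hdisj0 : ∀ i j : ℕ, ∀ w, (n ^ i)⁻¹ w ∈ HT T x y → (n ^ (i + j + 1))⁻¹ w ∉ HT T x y := by
    intro i j w h1 h2
    have h3 := F1 j _ (hcP (hA h2))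
    have e : (n ^ (j + 1)) ((n ^ (i + j + 1))⁻¹ w) = (n ^ i)⁻¹ w := by
      rw [← Equiv.Perm.mul_apply]
      congr 1
      group
    rw [e] at h3
    exact hbc' _ h3 (hA h1)
  have hvinj : ∀ i j : ℕ, (n ^ i) v = (n ^ j) v → i = j := by
    have key : ∀ i j : ℕ, (n ^ i) v ≠ (n ^ (i + j + 1)) v := by
      intro i j e
      rw [add_assoc, pow_add, Equiv.Perm.mul_apply] at e
      have := (n ^ i).injective e
      have h1 := F1 j v hvP
      rw [← this] at h1
      exact hvb h1
    intro i j e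
    rcases lt_trichotomy i j with h | h | h
    · obtain ⟨l, rfl⟩ := Nat.exists_eq_add_of_lt h
      exact absurd e (key _ _)
    · exact h
    · obtain ⟨l, rfl⟩ := Nat.exists_eq_add_of_lt h
      exact absurd e.symm (key _ _)
  have hfi : ∀ w, f w = w → f⁻¹ w = w := fun w h => by
    rw [Equiv.Perm.inv_eq_iff_eq, h]
  have hfA : ∀ w, w ∉ HT T x y → f w = w := fun w h => hf2 w ((not_mem_HT hT hxy).1 h)
  have hfpres : ∀ w, w ∈ HT T x y → f⁻¹ w ∈ HT T x y := by
    intro w hw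
    by_contra hcon
    have := hfA _ hcon
    rw [pai] at this
    exact hcon (this ▸ hw)
  let φ : ℕ → Equiv.Perm V := fun i => n ^ i * f⁻¹ * (n ^ i)⁻¹
  have hφ : ∀ i u, φ i u = (n ^ i) (f⁻¹ ((n ^ i)⁻¹ u)) := fun i u => rfl
  have hφG : ∀ i, φ i ∈ G := fun i =>
    G.mul_mem (G.mul_mem (hng i) (G.inv_mem hf)) (G.inv_mem (hng i))
  have hφfix : ∀ i, ∀ u ∈ nbhd T C (k-1), φ i u = u := by
    rintro i u ⟨z, hz, hdz⟩
    have hz' := hCQ i z hz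
    rw [← pai (n ^ i) z, aut_HT hT (haut i)] at hz'
    have hzA : (n ^ i)⁻¹ z ∈ HT T y x := by
      rw [← not_mem_HT hT hxy]
      exact fun h => (not_mem_HT hT hc).2 (hA h) hz'
    have hd' : T.dist ((n ^ i)⁻¹ u) ((n ^ i)⁻¹ z) = T.dist u z :=
      aut_dist hT (hG _ (G.inv_mem (hng i))) u z
    have : f ((n ^ i)⁻¹ u) = (n ^ i)⁻¹ u := by
      by_cases hu : (n ^ i)⁻¹ u ∈ HT T x y
      · have := gate hT hxy.symm hu hzA
        exact hf1 _ ⟨y, by simp, by omega⟩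
      · exact hfA _ hu
    rw [hφ, hfi _ this, pai]
  let h : V → Equiv.Perm V := fun z => if H : ∃ i : ℕ, z = (n ^ i) v then φ H.choose else 1
  have hh : ∀ i : ℕ, h ((n ^ i) v) = φ i := by
    intro i
    have H : ∃ j : ℕ, (n ^ i) v = (n ^ j) v := ⟨i, rfl⟩
    have e : H.choose = i := (hvinj _ _ H.choose_spec).symm
    simp only [h]
    rw [dif_pos H, e]
  have hh' : ∀ z, (¬ ∃ i : ℕ, z = (n ^ i) v) → h z = 1 := by
    intro z hz
    simp only [h]
    rw [dif_neg hz]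
  obtain ⟨g, hgG, hgfix, hgact⟩ := (hPk C hC).2 h (by
    intro z _
    by_cases H : ∃ i : ℕ, z = (n ^ i) v
    · obtain ⟨i, rfl⟩ := H
      rw [hh]
      exact ⟨hφG i, hφfix i⟩
    · rw [hh' z H]
      exact ⟨G.one_mem, fun _ _ => rfl⟩)
  have G1 : ∀ i : ℕ, ∀ u, (n ^ i)⁻¹ u ∈ HT T x y → g u = φ i u := by
    intro i u hu
    rw [hgact _ (hvC i) u (hproj i u hu), hh]
  have G2 : ∀ u, (∀ i : ℕ, (n ^ i)⁻¹ u ∉ HT T x y) → g u = u := by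
    intro u hu
    obtain ⟨z, hz, hmin⟩ := (measure (fun z => T.dist u z)).wf.has_min C ⟨_, hvC 0⟩
    rw [hgact z hz u (fun c hc => not_lt.1 (hmin c hc))]
    by_cases H : ∃ i : ℕ, z = (n ^ i) v
    · obtain ⟨i, rfl⟩ := H
      rw [hh, hφ, hfi _ (hfA _ (hu i)), pai]
    · rw [hh' z H]
      rfl
  have hshift : ∀ (j : ℕ) u, (n ^ j)⁻¹ (n⁻¹ u) = (n ^ (j + 1))⁻¹ u := by
    intro j u
    rw [← Equiv.Perm.mul_apply]
    congr 1
    group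
  have hmain : f * g = n * g * n⁻¹ := by
    ext u
    simp only [Equiv.Perm.mul_apply]
    by_cases hex : ∃ i : ℕ, (n ^ i)⁻¹ u ∈ HT T x y
    · obtain ⟨i, hi⟩ := hex
      cases i with
      | zero =>
        have e1 : g u = f⁻¹ u := by simpa [hφ] using G1 0 u hi
        have e2 : g (n⁻¹ u) = n⁻¹ u := by
          apply G2
          intro j
          rw [hshift]
          simpa using hdisj0 0 j u hi
        rw [e1, e2, pai, pai]
      | succ j =>
        have e1 := G1 (j + 1) u hi
        have e2 := G1 j (n⁻¹ u) (by rw [hshift]; exact hi)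
        have e3 : f (φ (j + 1) u) = φ (j + 1) u := by
          apply hfA
          intro hcon
          have h1 := hfpres _ hi
          have h2 := hdisj0 0 j (φ (j+1) u) (by simpa using hcon)
          apply h2
          rw [hφ, zero_add, pia]
          exact h1
        rw [e1, e2, e3, hφ, hφ, hshift, pow_succ', Equiv.Perm.mul_apply]
    · push Not at hex
      rw [G2 u hex, G2 (n⁻¹ u) (fun j => by rw [hshift]; exact hex _), pai]
      exact hfA u (by simpa using hex 0)
  have hgH : g ∈ plusSubgroup T (G : Set (Equiv.Perm V)) k := by
    apply Subgroup.subset_closure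
    refine ⟨hgG, v, b, hb, ?_⟩
    rintro w ⟨z, hz, hdz⟩
    apply hgfix
    refine ⟨z, ?_, hdz⟩
    rcases hz with rfl | hz
    · simpa using hvC 0
    · rw [Set.mem_singleton_iff] at hz
      subst hz
      refine ⟨1, ?_⟩
      have h1 : T.dist (n v) z < T.dist (n v) v := hP v hvP
      have h2 := step hT (n v) hb
      have h3 : T.dist v z = 1 := dist_eq_one_iff_adj.2 hb
      change T.dist v z + T.dist z ((n ^ 1) v) = T.dist v ((n ^ 1) v)
      rw [pow_one, T.dist_comm (u := z), T.dist_comm (u := v) (v := n v)]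
      omega
  have hfe : f = n * (g * n⁻¹ * g⁻¹) := by
    rw [← mul_assoc, ← mul_assoc, ← hmain]
    group
  rw [hfe]
  exact N.mul_mem hn (hnorm g hgH _ (N.inv_mem hn))

theorem plus_le (hT : T.IsTree) (hline : NotLine T) {k : ℕ}
    {G N : Subgroup (Equiv.Perm V)} (hG : ∀ g ∈ G, IsTreeAut T g)
    (hinv : ∀ g ∈ G, ¬ IsInversion T g)
    (hPk : PropertyPk T (G : Set (Equiv.Perm V)) k)
    (hNG : N ≤ G) (hd : Dense T N)
    (hnorm : ∀ g ∈ plusSubgroup T (G : Set (Equiv.Perm V)) k, ∀ n ∈ N, g * n * g⁻¹ ∈ N) :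
    plusSubgroup T (G : Set (Equiv.Perm V)) k ≤ N := by
  classical
  unfold plusSubgroup
  rw [Subgroup.closure_le]
  rintro f ⟨hf, x, y, hxy, hfix⟩
  have hC : IsPathSet T ({x, y} : Set V) := by
    refine ⟨⟨x, by simp⟩, IsConvex_of_BConv hT ?_, ?_⟩
    · have h1 : T.dist x y = 1 := dist_eq_one_iff_adj.2 hxy
      have h1' : T.dist y x = 1 := dist_eq_one_iff_adj.2 hxy.symm
      intro u hu v hv w hw
      have hle : T.dist u v ≤ 1 := by
        rcases hu with rfl | rfl <;> rcases hv with rfl | rfl <;> simp [h1, h1']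
      by_cases e : T.dist u w = 0
      · rw [← (dzero hT).1 e]; exact hu
      · rw [(dzero hT).1 (by omega : T.dist w v = 0)]; exact hv
    · rintro z - w1 h1 w2 h2 w3 h3 - - -
      simp only [Set.mem_insert_iff, Set.mem_singleton_iff] at h1 h2 h3
      rcases h1 with rfl | rfl <;> rcases h2 with rfl | rfl <;> rcases h3 with rfl | rfl <;> simp
  obtain ⟨f1, hf1, hf1fix, hf1act⟩ := (hPk _ hC).2 (fun z => if z = x then f else 1) (by
    intro z _
    by_cases e : z = x
    · simp only [e, if_true]
      exact ⟨hf, hfix⟩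
    · simp only [e, if_false]
      exact ⟨G.one_mem, fun _ _ => rfl⟩)
  have hpx : ∀ w ∈ HT T x y, f1 w = f w := by
    intro w hw
    have hw' : T.dist w x < T.dist w y := hw
    have := hf1act x (by simp) w (by
      rintro c (rfl | hc)
      · exact le_rfl
      · rw [Set.mem_singleton_iff] at hc
        subst hc
        exact hw'.le)
    simpa using this
  have hpy : ∀ w ∈ HT T y x, f1 w = w := by
    intro w hw
    have hw' : T.dist w y < T.dist w x := hw
    have := hf1act y (by simp) w (by
      rintro c (rfl | hc)
      · exact hw'.le
      · rw [Set.mem_singleton_iff] at hc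
        subst hc
        exact le_rfl)
    simpa [hxy.ne'] using this
  have m1 : f1 ∈ N := half_mem hT hline hG hinv hPk hNG hd hnorm hxy hf1 hf1fix hpy
  have m2 : f1⁻¹ * f ∈ N := by
    refine half_mem hT hline hG hinv hPk hNG hd hnorm hxy.symm (G.mul_mem (G.inv_mem hf1) hf) ?_ ?_
    · intro w hw
      rw [Set.pair_comm] at hw
      rw [Equiv.Perm.mul_apply, hfix w hw, Equiv.Perm.inv_eq_iff_eq, hf1fix w hw]
    · intro w hw
      rw [Equiv.Perm.mul_apply, Equiv.Perm.inv_eq_iff_eq, hpx w hw]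
  have : f = f1 * (f1⁻¹ * f) := by group
  rw [SetLike.mem_coe, this]
  exact N.mul_mem m1 m2

theorem plus_le_G {k : ℕ} {G : Subgroup (Equiv.Perm V)} :
    plusSubgroup T (G : Set (Equiv.Perm V)) k ≤ G := by
  unfold plusSubgroup
  rw [Subgroup.closure_le]
  rintro f ⟨hf, -⟩
  exact hf

theorem plus_normal (hT : T.IsTree) {k : ℕ} {G : Subgroup (Equiv.Perm V)}
    (hG : ∀ g ∈ G, IsTreeAut T g) :
    ∀ g ∈ G, ∀ n ∈ plusSubgroup T (G : Set (Equiv.Perm V)) k,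
      g * n * g⁻¹ ∈ plusSubgroup T (G : Set (Equiv.Perm V)) k := by
  intro g hg n hn
  have hle : plusSubgroup T (G : Set (Equiv.Perm V)) k ≤
      (plusSubgroup T (G : Set (Equiv.Perm V)) k).comap (MulAut.conj g).toMonoidHom := by
    conv_lhs => unfold plusSubgroup
    rw [Subgroup.closure_le]
    rintro f ⟨hf, x, y, hxy, hfix⟩
    change g * f * g⁻¹ ∈ plusSubgroup T (G : Set (Equiv.Perm V)) k
    apply Subgroup.subset_closure
    refine ⟨G.mul_mem (G.mul_mem hg hf) (G.inv_mem hg), g x, g y, (hG g hg _ _).2 hxy, ?_⟩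
    rintro w ⟨z, hz, hd⟩
    have : f (g⁻¹ w) = g⁻¹ w := by
      apply hfix
      refine ⟨g⁻¹ z, ?_, ?_⟩
      · rcases hz with rfl | hz
        · simp
        · rw [Set.mem_singleton_iff] at hz
          subst hz
          simp
      · rw [aut_dist hT (hG _ (G.inv_mem hg))]
        exact hd
    rw [Equiv.Perm.mul_apply, Equiv.Perm.mul_apply, this, pai]
  exact hle hn

end main

end TitsAux

/-- Tits' simplicity theorem (k-version): a geometrically dense group of automorphisms
without inversions satisfying Property P_k has G^{+_k} trivial or abstractly simple. -/
theorem tits_simplicity {V : Type*} [Countable V]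
    (T : SimpleGraph V) (hT : T.IsTree) (hline : NotLine T) (k : ℕ) (hk : 1 ≤ k)
    (G : Subgroup (Equiv.Perm V)) (hG : ∀ g ∈ G, IsTreeAut T g)
    (hinv : ∀ g ∈ G, ¬ IsInversion T g)
    (hgd : GeomDense T (G : Set (Equiv.Perm V)))
    (hPk : PropertyPk T (G : Set (Equiv.Perm V)) k) :
    plusSubgroup T (G : Set (Equiv.Perm V)) k = ⊥ ∨
      IsSimpleGroup ↥(plusSubgroup T (G : Set (Equiv.Perm V)) k) := by
  classical
  by_cases hbot : plusSubgroup T (G : Set (Equiv.Perm V)) k = ⊥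
  · exact Or.inl hbot
  right
  have hHG := TitsAux.plus_le_G (T := T) (k := k) (G := G)
  have hnorm := TitsAux.plus_normal (k := k) hT hG
  have hdG := TitsAux.dense_of_geomDense hT hgd
  have hdH := TitsAux.dense_normal hT hline hG hdG hHG hbot hnorm
  have hnt : Nontrivial ↥(plusSubgroup T (G : Set (Equiv.Perm V)) k) :=
    (Subgroup.nontrivial_iff_ne_bot _).2 hbot
  refine { eq_bot_or_eq_top_of_normal := fun M hM => ?_ }
  by_cases hMb : M = ⊥
  · exact Or.inl hMb
  right
  have hNH : M.map (plusSubgroup T (G : Set (Equiv.Perm V)) k).subtype ≤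
      plusSubgroup T (G : Set (Equiv.Perm V)) k := Subgroup.map_subtype_le M
  have hNn : ∀ g ∈ plusSubgroup T (G : Set (Equiv.Perm V)) k,
      ∀ n ∈ M.map (plusSubgroup T (G : Set (Equiv.Perm V)) k).subtype,
      g * n * g⁻¹ ∈ M.map (plusSubgroup T (G : Set (Equiv.Perm V)) k).subtype := by
    rintro g hg _ ⟨n, hn, rfl⟩
    exact ⟨⟨g, hg⟩ * n * ⟨g, hg⟩⁻¹, hM.conj_mem n hn ⟨g, hg⟩, rfl⟩
  have hNb : M.map (plusSubgroup T (G : Set (Equiv.Perm V)) k).subtype ≠ ⊥ := by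
    intro e
    apply hMb
    rw [Subgroup.eq_bot_iff_forall] at e ⊢
    intro n hn
    exact Subtype.ext (e _ ⟨n, hn, rfl⟩)
  have hdN := TitsAux.dense_normal hT hline (fun g hg => hG g (hHG hg)) hdH hNH hNb hNn
  have hle := TitsAux.plus_le hT hline hG hinv hPk (hNH.trans hHG) hdN hNn
  rw [eq_top_iff]
  rintro ⟨g, hg⟩ -
  obtain ⟨n, hn, e⟩ := hle hg
  have : n = ⟨g, hg⟩ := Subtype.ext e
  exact this ▸ hn
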